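/- arXiv:1503.08898 — 6 statements merged into one kernel-verified Lean document; each statement's English description precedes it below -/
import Mathlib

section
/- Let P be a finite poset and let p, q be distinct elements of P. The toggles t_p and t_q commute, i.e. t_p ∘ t_q = t_q ∘ t_p as maps J(P) → J(P), if and only if neither p covers q nor q covers p in P. -/
open scoped Classical

/-- The set of order ideals (lower sets) of a poset `P`. -/
abbrev OrderIdeal (P : Type*) [PartialOrder P] := {I : Set P // IsLowerSet I}

variable {P : Type*} [PartialOrder P]

/-- The toggle `t_p : J(P) → J(P)`: it adds `p` if `p` is a minimal element of the
complement of `I`, removes `p` if `p` is a maximal element of `I`, and otherwise fixes `I`. -/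
noncomputable def toggle (p : P) (I : OrderIdeal P) : OrderIdeal P :=
  if h₁ : p ∉ I.1 ∧ ∀ q, q < p → q ∈ I.1 then
    ⟨I.1 ∪ {p}, by
      intro a b hba ha
      rcases ha with ha | ha
      · exact Or.inl (I.2 hba ha)
      · rw [Set.mem_singleton_iff] at ha
        subst ha
        rcases eq_or_lt_of_le hba with h | h
        · exact Or.inr (by rw [Set.mem_singleton_iff]; exact h)
        · exact Or.inl (h₁.2 b h)⟩
  else if h₂ : p ∈ I.1 ∧ ∀ q, p < q → q ∉ I.1 then
    ⟨I.1 \ {p}, by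
      intro a b hba ha
      refine ⟨I.2 hba ha.1, ?_⟩
      intro hb
      rw [Set.mem_singleton_iff] at hb
      subst hb
      rcases eq_or_lt_of_le hba with h | h
      · exact ha.2 (by rw [Set.mem_singleton_iff]; exact h.symm)
      · exact h₂.2 a h ha.1⟩
  else I

theorem mem_toggle_ne {p x : P} (I : OrderIdeal P) (h : x ≠ p) :
    x ∈ (toggle p I).1 ↔ x ∈ I.1 := by
  unfold toggle
  split_ifs <;> simp [h]

theorem mem_toggle_self (p : P) (I : OrderIdeal P) :
    p ∈ (toggle p I).1 ↔ (p ∉ I.1 ∧ ∀ q, q < p → q ∈ I.1) ∨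
      (p ∈ I.1 ∧ ¬ ∀ q, p < q → q ∉ I.1) := by
  unfold toggle
  split_ifs with h₁ h₂
  · simp only [Set.union_singleton, Set.mem_insert_iff, true_or, true_iff]
    exact Or.inl h₁
  · simp only [Set.mem_diff, Set.mem_singleton_iff, not_true_eq_false, and_false, false_iff]
    tauto
  · tauto

theorem toggle_aux {p q : P} (hpq : p ≠ q) (h1 : ¬ p ⋖ q) (h2 : ¬ q ⋖ p) (I : OrderIdeal P) :
    p ∈ (toggle p (toggle q I)).1 ↔ p ∈ (toggle p I).1 := by
  rw [mem_toggle_self, mem_toggle_self, mem_toggle_ne I hpq]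
  have hA : (∀ x, x < p → x ∈ (toggle q I).1) ↔ ∀ x, x < p → x ∈ I.1 := by
    constructor
    · intro h x hx
      by_cases hxq : x = q
      · subst hxq
        obtain ⟨r, hr1, hr2⟩ := exists_lt_lt_of_not_covBy hx h2
        exact I.2 hr1.le ((mem_toggle_ne I hr1.ne').1 (h r hr2))
      · exact (mem_toggle_ne I hxq).1 (h x hx)
    · intro h x hx
      by_cases hxq : x = q
      · subst hxq
        obtain ⟨r, hr1, hr2⟩ := exists_lt_lt_of_not_covBy hx h2
        exact (mem_toggle_self x I).2 (Or.inr ⟨h x hx, fun hh => hh r hr1 (h r hr2)⟩)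
      · exact (mem_toggle_ne I hxq).2 (h x hx)
  have hB : (∀ x, p < x → x ∉ (toggle q I).1) ↔ ∀ x, p < x → x ∉ I.1 := by
    constructor
    · intro h x hx hxI
      by_cases hxq : x = q
      · subst hxq
        obtain ⟨r, hr1, hr2⟩ := exists_lt_lt_of_not_covBy hx h1
        exact h r hr1 ((mem_toggle_ne I hr2.ne).2 (I.2 hr2.le hxI))
      · exact h x hx ((mem_toggle_ne I hxq).2 hxI)
    · intro h x hx hxI
      by_cases hxq : x = q
      · subst hxq
        obtain ⟨r, hr1, hr2⟩ := exists_lt_lt_of_not_covBy hx h1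
        exact h r hr1 ((mem_toggle_ne I hr2.ne).1 ((toggle x I).2 hr2.le hxI))
      · exact h x hx ((mem_toggle_ne I hxq).1 hxI)
  rw [hA, hB]

theorem toggle_not_comm {p q : P} (h : p ⋖ q) :
    toggle p ∘ toggle q ≠ toggle q ∘ toggle p := by
  intro hc
  let I : OrderIdeal P := ⟨{x | x < q ∧ x ≠ p}, by
    rintro a b hba ⟨ha, hap⟩
    refine ⟨hba.trans_lt ha, ?_⟩
    rintro rfl
    exact h.2 (lt_of_le_of_ne hba (Ne.symm hap)) ha⟩
  have hpI : p ∉ I.1 := fun hh => hh.2 rfl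
  have hqI : q ∉ I.1 := fun hh => lt_irrefl _ hh.1
  have e := congrFun hc I
  have hL : q ∉ (toggle p (toggle q I)).1 := by
    rw [mem_toggle_ne _ h.1.ne', mem_toggle_self]
    rintro (⟨_, hh⟩ | ⟨hh, _⟩)
    · exact hpI (hh p h.1)
    · exact hqI hh
  have hR : q ∈ (toggle q (toggle p I)).1 := by
    rw [mem_toggle_self, mem_toggle_ne _ h.1.ne']
    refine Or.inl ⟨hqI, fun x hx => ?_⟩
    by_cases hxp : x = p
    · subst hxp
      exact (mem_toggle_self x I).2 (Or.inl ⟨hpI, fun y hy => ⟨hy.trans hx, hy.ne⟩⟩)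
    · exact (mem_toggle_ne I hxp).2 ⟨hx, hxp⟩
  simp only [Function.comp_apply] at e
  rw [e] at hL
  exact hL hR

/-- Two toggles `t_p`, `t_q` at distinct elements of a finite poset commute as maps
`J(P) → J(P)` if and only if neither `p` covers `q` nor `q` covers `p`. -/
theorem stmt_0 [Fintype P] (p q : P) (hpq : p ≠ q) :
    (toggle p ∘ toggle q = toggle q ∘ toggle p) ↔ (¬ p ⋖ q ∧ ¬ q ⋖ p) := by
  constructor
  · intro hc
    exact ⟨fun h => toggle_not_comm h hc, fun h => toggle_not_comm h hc.symm⟩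
  · rintro ⟨h1, h2⟩
    funext I
    apply Subtype.ext
    ext x
    simp only [Function.comp_apply]
    by_cases hp : x = p
    · subst hp
      rw [toggle_aux hpq h1 h2, mem_toggle_ne _ hpq]
    · by_cases hq : x = q
      · subst hq
        rw [toggle_aux hpq.symm h2 h1, mem_toggle_ne _ hpq.symm]
      · rw [mem_toggle_ne _ hp, mem_toggle_ne _ hq, mem_toggle_ne _ hq, mem_toggle_ne _ hp]
end

section
/- Let P be a finite poset and p ∈ P. The toggleability statistic T_p is 0-mesic with respect to rowmotion: for every orbit O of row acting on J(P), the sum of T_p(I) over all I ∈ O equals 0. -/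
open scoped Classical

variable {P : Type*} [PartialOrder P]

/-- Rowmotion: `I` is sent to the order ideal generated by the minimal elements of `P∖I`. -/
noncomputable def rowmotion (I : OrderIdeal P) : OrderIdeal P :=
  ⟨{x | ∃ m, m ∉ I.1 ∧ (∀ q, q < m → q ∈ I.1) ∧ x ≤ m}, by
    intro a b hba ha
    obtain ⟨m, h1, h2, h3⟩ := ha
    exact ⟨m, h1, h2, hba.trans h3⟩⟩

/-- The toggleability statistic `T_p`. -/
noncomputable def togStat (p : P) (I : OrderIdeal P) : ℤ :=
  if p ∉ I.1 ∧ ∀ q, q < p → q ∈ I.1 then 1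
  else if p ∈ I.1 ∧ ∀ q, p < q → q ∉ I.1 then -1
  else 0


lemma row_max_iff (p : P) (I : OrderIdeal P) :
    (p ∈ (rowmotion I).1 ∧ ∀ q, p < q → q ∉ (rowmotion I).1) ↔
      (p ∉ I.1 ∧ ∀ q, q < p → q ∈ I.1) := by
  constructor
  · rintro ⟨⟨m, h1, h2, h3⟩, h⟩
    rcases eq_or_lt_of_le h3 with e | e
    · subst e; exact ⟨h1, h2⟩
    · exact absurd ⟨m, h1, h2, le_rfl⟩ (h m e)
  · rintro ⟨h1, h2⟩
    refine ⟨⟨p, h1, h2, le_rfl⟩, ?_⟩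
    rintro q hq ⟨m, k1, k2, k3⟩
    exact h1 (k2 p (lt_of_lt_of_le hq k3))

lemma row_sub [Finite P] {I J : OrderIdeal P} (h : rowmotion I = rowmotion J) :
    I.1 ⊆ J.1 := by
  intro x hx
  by_contra hxJ
  obtain ⟨m, hm, hmin⟩ := (Set.toFinite {y | y ∉ J.1 ∧ y ≤ x}).exists_minimal ⟨x, hxJ, le_rfl⟩
  have hJ : m ∉ J.1 ∧ ∀ q, q < m → q ∈ J.1 := by
    refine ⟨hm.1, fun q hq => ?_⟩
    by_contra hqJ
    exact absurd (hmin ⟨hqJ, hq.le.trans hm.2⟩ hq.le) hq.not_ge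
  rw [← row_max_iff, ← h, row_max_iff] at hJ
  exact hJ.1 (I.2 hm.2 hx)

lemma row_inj [Finite P] : Function.Injective (rowmotion : OrderIdeal P → OrderIdeal P) :=
  fun _ _ h => Subtype.ext (Set.Subset.antisymm (row_sub h) (row_sub h.symm))

lemma togStat_eq (p : P) (J : OrderIdeal P) : togStat p J =
    (if p ∉ J.1 ∧ ∀ q, q < p → q ∈ J.1 then (1 : ℤ) else 0) -
    (if p ∈ J.1 ∧ ∀ q, p < q → q ∉ J.1 then (1 : ℤ) else 0) := by
  unfold togStat
  by_cases h : p ∈ J.1 <;> simp [h]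
  split_ifs <;> simp

/-- For any finite poset `P` and `p ∈ P`, the toggleability statistic `T_p` is 0-mesic
with respect to rowmotion: the sum of `T_p` over every orbit of rowmotion on `J(P)` is `0`.
(The orbit of `I` is the set of all iterates of `I` under rowmotion.) -/
theorem stmt_4 [Fintype P] (p : P) (I : OrderIdeal P) :
    ∑ J ∈ Finset.univ.filter (fun J => ∃ k : ℕ, rowmotion^[k] I = J), togStat p J = 0 := by
  set S := Finset.univ.filter (fun J => ∃ k : ℕ, rowmotion^[k] I = J) with hS
  have himg : S.image rowmotion = S := by
    apply Finset.eq_of_subset_of_card_le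
    · intro J hJ
      obtain ⟨K, hK, rfl⟩ := Finset.mem_image.1 hJ
      obtain ⟨k, hk⟩ := (Finset.mem_filter.1 hK).2
      exact Finset.mem_filter.2 ⟨Finset.mem_univ _, k + 1, by
        rw [Function.iterate_succ_apply', hk]⟩
    · rw [Finset.card_image_of_injective _ row_inj]
  simp only [togStat_eq]
  rw [Finset.sum_sub_distrib, sub_eq_zero]
  conv_rhs => rw [← himg]
  rw [Finset.sum_image (fun _ _ _ _ h => row_inj h)]
  refine Finset.sum_congr rfl fun J _ => ?_
  have h := row_max_iff p J
  split_ifs <;> first | rfl | (exfalso; tauto)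
end

section
/- Let P be a finite ranked poset. Then gyration gyr and rowmotion row are conjugate in the toggle group: there exists a bijection g : J(P) → J(P) that is a finite composition of toggles t_p such that gyr = g ∘ row ∘ g⁻¹. In particular, J(P) under row and J(P) under gyr are in equivariant bijection. -/
open scoped Classical

variable {P : Type*} [PartialOrder P]

/-- Gyration: first toggle all elements of even rank, then all elements of odd rank.
(Toggles at distinct elements whose ranks have equal parity commute, so this is
independent of the order chosen within each parity class.) -/
noncomputable def gyration [Fintype P] (rk : P → ℕ) : OrderIdeal P → OrderIdeal P :=
  (((Finset.univ.filter fun p : P => rk p % 2 = 1).toList.map toggle).foldr (· ∘ ·) id) ∘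
    (((Finset.univ.filter fun p : P => rk p % 2 = 0).toList.map toggle).foldr (· ∘ ·) id)



theorem mem_toggle (p : P) (I : OrderIdeal P) (x : P) :
    x ∈ (toggle p I).1 ↔
      if x = p then (∀ q, q < p → q ∈ I.1) ∧ (p ∈ I.1 → ∃ q, p < q ∧ q ∈ I.1) else x ∈ I.1 := by
  unfold toggle
  have hI : p ∈ I.1 → ∀ q, q < p → q ∈ I.1 := fun h q hq => I.2 hq.le h
  split_ifs with h1 h2 h3 h3 h2 <;> try simp only [Set.mem_union, Set.mem_sdiff, Set.mem_singleton_iff]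
  all_goals grind

theorem mem_toggle_cov [Finite P] (p : P) (I : OrderIdeal P) (x : P) :
    x ∈ (toggle p I).1 ↔
      if x = p then (∀ q, q ⋖ p → q ∈ I.1) ∧ (p ∈ I.1 → ∃ q, p ⋖ q ∧ q ∈ I.1) else x ∈ I.1 := by
  cases nonempty_fintype P
  letI : LocallyFiniteOrder P := Fintype.toLocallyFiniteOrder
  rw [mem_toggle]
  have a : (∀ q, q < p → q ∈ I.1) ↔ (∀ q, q ⋖ p → q ∈ I.1) := by
    refine ⟨fun h q hq => h q hq.lt, fun h q hq => ?_⟩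
    obtain ⟨c, h1, h2⟩ := exists_le_covBy_of_lt hq
    exact I.2 h1 (h c h2)
  have b : (∃ q, p < q ∧ q ∈ I.1) ↔ (∃ q, p ⋖ q ∧ q ∈ I.1) := by
    refine ⟨fun ⟨q, hq, hi⟩ => ?_, fun ⟨q, h, hi⟩ => ⟨q, h.lt, hi⟩⟩
    obtain ⟨c, h1, h2⟩ := exists_covBy_le_of_lt hq
    exact ⟨c, h1, I.2 h2 hi⟩
  rw [a, b]

theorem toggle_invol (p : P) : Function.Involutive (toggle p) := by
  intro I
  apply Subtype.ext
  ext x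
  have hI : p ∈ I.1 → ∀ q, q < p → q ∈ I.1 := fun h q hq => I.2 hq.le h
  have hI' : ∀ q, p < q → q ∈ I.1 → p ∈ I.1 := fun q hq h => I.2 hq.le h
  have key : ∀ q, q ≠ p → (q ∈ (toggle p I).1 ↔ q ∈ I.1) := fun q hq => by
    rw [mem_toggle, if_neg hq]
  have kp := mem_toggle p I p
  rw [if_pos rfl] at kp
  rw [mem_toggle]
  split_ifs with h
  · subst h
    have a : (∀ q, q < x → q ∈ (toggle x I).1) ↔ (∀ q, q < x → q ∈ I.1) :=
      forall_congr' fun q => imp_congr_right fun h => key q h.ne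
    have b : (∃ q, x < q ∧ q ∈ (toggle x I).1) ↔ (∃ q, x < q ∧ q ∈ I.1) :=
      exists_congr fun q => and_congr_right fun h => key q h.ne'
    rw [a, b, kp]
    constructor
    · rintro ⟨h1, h2⟩
      by_contra hx
      obtain ⟨q, hq, hq'⟩ := h2 ⟨h1, fun h => absurd h hx⟩
      exact hx (hI' q hq hq')
    · intro hx
      exact ⟨hI hx, fun h => h.2 hx⟩
  · exact key x h

theorem toggle_comm [Finite P] (p q : P) (h1 : ¬ p ⋖ q) (h2 : ¬ q ⋖ p) (I : OrderIdeal P) :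
    toggle p (toggle q I) = toggle q (toggle p I) := by
  by_cases hpq : p = q
  · rw [hpq]
  have gen : ∀ p q : P, p ≠ q → ¬ p ⋖ q → ¬ q ⋖ p →
      (p ∈ (toggle p (toggle q I)).1 ↔ p ∈ (toggle p I).1) := by
    intro p q hpq h1 h2
    have key : ∀ r, r ≠ q → (r ∈ (toggle q I).1 ↔ r ∈ I.1) := fun r hr => by
      rw [mem_toggle, if_neg hr]
    rw [mem_toggle_cov p _ p, mem_toggle_cov p _ p, if_pos rfl, if_pos rfl]
    refine and_congr (forall_congr' fun r => imp_congr_right fun h => key r ?_)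
      (imp_congr (key p hpq) (exists_congr fun r => and_congr_right fun h => key r ?_))
    · rintro rfl; exact h2 h
    · rintro rfl; exact h1 h
  apply Subtype.ext
  ext x
  by_cases hx : x = p
  · subst hx
    rw [gen x q hpq h1 h2, mem_toggle q _ x, if_neg hpq]
  by_cases hx' : x = q
  · subst hx'
    rw [gen x p hx h2 h1, mem_toggle p _ x, if_neg hx]
  · simp [mem_toggle, hx, hx']

/-- The toggle as a permutation. -/
noncomputable def togglePerm (p : P) : Equiv.Perm (OrderIdeal P) := (toggle_invol p).toPerm

/-- Product of toggles along a list; the last one is applied first. -/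
noncomputable def listPerm (l : List P) : Equiv.Perm (OrderIdeal P) := (l.map togglePerm).prod

theorem listPerm_append (l m : List P) : listPerm (l ++ m) = listPerm l * listPerm m := by
  simp [listPerm]

theorem coe_listPerm (l : List P) : ⇑(listPerm l) = (l.map toggle).foldr (· ∘ ·) id := by
  induction l with
  | nil => rfl
  | cons a l ih =>
    rw [List.map_cons, List.foldr_cons, ← ih]
    rfl

theorem listPerm_reverse (l : List P) : listPerm l.reverse = (listPerm l)⁻¹ := by
  induction l with
  | nil => simp [listPerm]
  | cons a l ih =>
    have : (togglePerm a)⁻¹ = togglePerm a := rfl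
    rw [List.reverse_cons, listPerm_append, ih]
    simp [listPerm, this]

theorem listPerm_row (I : OrderIdeal P) (l : List P) (hp : l.Pairwise (fun a b => ¬ b ≤ a))
    (hu : ∀ x ∈ l, ∀ y, x < y → y ∈ l) (x : P) :
    x ∈ (listPerm l I).1 ↔ if x ∈ l then x ∈ (rowmotion I).1 else x ∈ I.1 := by
  induction l generalizing x with
  | nil => simp [listPerm]
  | cons p l ih =>
    rw [List.pairwise_cons] at hp
    have hu' : ∀ x ∈ l, ∀ y, x < y → y ∈ l := by
      intro x hx y hy
      rcases List.mem_cons.1 (hu x (List.mem_cons_of_mem _ hx) y hy) with h | h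
      · subst h; exact absurd hy.le (hp.1 x hx)
      · exact h
    have hup : ∀ y, p < y → y ∈ l := by
      intro y hy
      rcases List.mem_cons.1 (hu p List.mem_cons_self y hy) with h | h
      · exact absurd h hy.ne'
      · exact h
    have hpl : p ∉ l := fun h => hp.1 p h le_rfl
    have hd : ∀ y, y < p → y ∉ l := fun y hy h => hp.1 y h hy.le
    have ih' := ih hp.2 hu'
    have e : listPerm (p :: l) I = toggle p (listPerm l I) := rfl
    rw [e, mem_toggle]
    by_cases hx : x = p
    · subst hx
      rw [if_pos rfl, if_pos List.mem_cons_self]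
      have a : (∀ q, q < x → q ∈ (listPerm l I).1) ↔ (∀ q, q < x → q ∈ I.1) :=
        forall_congr' fun q => imp_congr_right fun h => by rw [ih' q, if_neg (hd q h)]
      have b : (∃ q, x < q ∧ q ∈ (listPerm l I).1) ↔ (∃ q, x < q ∧ q ∈ (rowmotion I).1) :=
        exists_congr fun q => and_congr_right fun h => by rw [ih' q, if_pos (hup q h)]
      rw [a, b, ih' x, if_neg hpl]
      constructor
      · rintro ⟨h1, h2⟩
        by_cases hxI : x ∈ I.1
        · obtain ⟨q, hq, hq'⟩ := h2 hxI
          exact (rowmotion I).2 hq.le hq'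
        · exact ⟨x, hxI, h1, le_rfl⟩
      · rintro ⟨m, h1, h2, h3⟩
        refine ⟨fun q hq => h2 q (hq.trans_le h3), fun hxI => ⟨m, ?_, m, h1, h2, le_rfl⟩⟩
        exact lt_of_le_of_ne h3 (by rintro rfl; exact h1 hxI)
    · rw [if_neg hx, ih' x]
      simp [hx]

section ranked
variable [Fintype P] (rk : P → ℕ)

/-- Elements of rank `n`. -/
noncomputable def layer (n : ℕ) : List P := (Finset.univ.filter fun p : P => rk p = n).toList

/-- Elements of rank less than `n` and of parity `e`. -/
noncomputable def parLt (e n : ℕ) : List P :=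
  (Finset.univ.filter fun p : P => rk p % 2 = e ∧ rk p < n).toList

/-- Elements of rank less than `n`, in increasing order of rank. -/
noncomputable def below : ℕ → List P
  | 0 => []
  | n + 1 => below n ++ layer rk n

theorem mem_layer (n : ℕ) (x : P) : x ∈ layer rk n ↔ rk x = n := by simp [layer]

theorem mem_parLt (e n : ℕ) (x : P) : x ∈ parLt rk e n ↔ rk x % 2 = e ∧ rk x < n := by
  simp [parLt]

theorem mem_below (n : ℕ) (x : P) : x ∈ below rk n ↔ rk x < n := by
  induction n with
  | zero => simp [below]
  | succ n ih => rw [below, List.mem_append, ih, mem_layer]; omega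

variable (hrk : ∀ p q : P, q ⋖ p → rk p = rk q + 1)

theorem rk_strictMono (hrk : ∀ p q : P, q ⋖ p → rk p = rk q + 1) : StrictMono rk := by
  letI : LocallyFiniteOrder P := Fintype.toLocallyFiniteOrder
  refine (strictMono_iff_forall_covBy rk).2 ?_
  intro a b h
  rw [hrk b a h]; omega

theorem commute_listPerm (hrk : ∀ p q : P, q ⋖ p → rk p = rk q + 1) (l m : List P)
    (h : ∀ a ∈ l, ∀ b ∈ m, rk a ≠ rk b + 1 ∧ rk b ≠ rk a + 1) :
    Commute (listPerm l) (listPerm m) := by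
  unfold listPerm
  apply Commute.list_prod_left
  intro x hx
  apply Commute.list_prod_right
  intro y hy
  obtain ⟨a, ha, rfl⟩ := List.mem_map.1 hx
  obtain ⟨b, hb, rfl⟩ := List.mem_map.1 hy
  apply Equiv.ext
  intro I
  exact toggle_comm a b (fun h' => (h a ha b hb).2 (hrk _ _ h'))
    (fun h' => (h a ha b hb).1 (hrk _ _ h')) I

theorem listPerm_perm (hrk : ∀ p q : P, q ⋖ p → rk p = rk q + 1) (l m : List P) (e : ℕ)
    (hlm : l.Perm m) (h : ∀ a ∈ l, rk a % 2 = e) : listPerm l = listPerm m := by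
  unfold listPerm
  apply List.Perm.prod_eq' (hlm.map _)
  rw [List.pairwise_map]
  apply List.pairwise_of_forall_mem_list
  intro a ha b hb
  have := commute_listPerm rk hrk [a] [b] (by
    intro x hx y hy
    rw [List.mem_singleton] at hx hy
    subst hx hy
    have := h _ ha
    have := h _ hb
    omega)
  simpa [listPerm] using this

theorem parLt_succ_ne (e n : ℕ) (h : n % 2 ≠ e) : parLt rk e (n + 1) = parLt rk e n := by
  unfold parLt
  congr 1
  ext x
  simp only [Finset.mem_filter, Finset.mem_univ, true_and]
  constructor
  · rintro ⟨h1, h2⟩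
    refine ⟨h1, ?_⟩
    by_contra h3
    have : rk x = n := by omega
    exact h (this ▸ h1)
  · rintro ⟨h1, h2⟩
    exact ⟨h1, by omega⟩

theorem parLt_succ_eq (hrk : ∀ p q : P, q ⋖ p → rk p = rk q + 1) (e n : ℕ) (h : n % 2 = e) :
    listPerm (parLt rk e (n + 1)) = listPerm (parLt rk e n) * listPerm (layer rk n) := by
  rw [← listPerm_append]
  apply listPerm_perm rk hrk _ _ e
  · rw [List.perm_ext_iff_of_nodup]
    · intro x
      rw [List.mem_append, mem_parLt, mem_parLt, mem_layer]
      constructor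
      · rintro ⟨h1, h2⟩
        by_cases h3 : rk x = n
        · exact Or.inr h3
        · exact Or.inl ⟨h1, by omega⟩
      · rintro (⟨h1, h2⟩ | h1)
        · exact ⟨h1, by omega⟩
        · subst h1; exact ⟨h, by omega⟩
    · exact Finset.nodup_toList _
    · refine List.Nodup.append (Finset.nodup_toList _) (Finset.nodup_toList _) ?_
      intro x hx hy
      have h1 := (mem_parLt rk e n x).1 hx
      have h2 := (mem_layer rk n x).1 hy
      omega
  · intro a ha
    exact ((mem_parLt rk _ _ _).1 ha).1

theorem conj_main (hrk : ∀ p q : P, q ⋖ p → rk p = rk q + 1) (n : ℕ) :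
    ∃ l : List P, (∀ a ∈ l, rk a + 1 < n) ∧
      listPerm l * listPerm (below rk n) * (listPerm l)⁻¹ =
        listPerm (parLt rk 1 n) * listPerm (parLt rk 0 n) := by
  induction n with
  | zero =>
    refine ⟨[], by simp, ?_⟩
    simp [below, parLt, listPerm]
  | succ n ih =>
    obtain ⟨l, hl, h⟩ := ih
    have hc : Commute (listPerm l) (listPerm (layer rk n)) := by
      apply commute_listPerm rk hrk
      intro a ha b hb
      have := hl a ha
      have := (mem_layer rk n b).1 hb
      omega
    have h' : listPerm l * listPerm (below rk (n + 1)) * (listPerm l)⁻¹ =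
        listPerm (parLt rk 1 n) * listPerm (parLt rk 0 n) * listPerm (layer rk n) := by
      rw [← h, below, listPerm_append, mul_assoc _ _ (listPerm (layer rk n)),
        hc.inv_left.eq]
      simp only [mul_assoc]
    rcases Nat.mod_two_eq_zero_or_one n with hn | hn
    · refine ⟨l, fun a ha => by have := hl a ha; omega, ?_⟩
      rw [h', parLt_succ_eq rk hrk 0 n hn, parLt_succ_ne rk 1 n (by omega), mul_assoc]
    · have hO : Commute (listPerm (parLt rk 1 n)) (listPerm (layer rk n)) := by
        apply commute_listPerm rk hrk
        intro a ha b hb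
        have := (mem_parLt rk 1 n a).1 ha
        have := (mem_layer rk n b).1 hb
        omega
      refine ⟨(parLt rk 0 n).reverse ++ ((parLt rk 1 n).reverse ++ l), ?_, ?_⟩
      · intro a ha
        simp only [List.mem_append, List.mem_reverse, mem_parLt] at ha
        rcases ha with ha | ha | ha
        · omega
        · omega
        · have := hl a ha; omega
      · rw [parLt_succ_eq rk hrk 1 n hn, parLt_succ_ne rk 0 n (by omega), hO.eq]
        rw [listPerm_append, listPerm_append, listPerm_reverse, listPerm_reverse]
        generalize listPerm (parLt rk 0 n) = E at *
        generalize listPerm (parLt rk 1 n) = O at *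
        generalize listPerm (layer rk n) = R at *
        generalize listPerm l = g at *
        generalize listPerm (below rk (n + 1)) = w at *
        have hw : w = g⁻¹ * (O * E * R) * g := by rw [← h']; group
        rw [hw, ← hO.eq]
        have : E⁻¹ * (O⁻¹ * g) * (g⁻¹ * (O * E * R) * g) * (E⁻¹ * (O⁻¹ * g))⁻¹ = R * O * E := by
          group
        rw [this, hO.eq]

theorem below_pairwise (hrk : ∀ p q : P, q ⋖ p → rk p = rk q + 1) (n : ℕ) :
    (below rk n).Pairwise (fun a b => ¬ b ≤ a) := by
  have hm := rk_strictMono rk hrk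
  induction n with
  | zero => simp [below]
  | succ n ih =>
    rw [below, List.pairwise_append]
    refine ⟨ih, ?_, ?_⟩
    · have hnd : (layer rk n).Nodup := Finset.nodup_toList _
      refine List.Pairwise.imp_of_mem ?_ hnd
      intro a b ha hb hab hle
      have h1 := (mem_layer rk n a).1 ha
      have h2 := (mem_layer rk n b).1 hb
      have := hm (lt_of_le_of_ne hle hab.symm)
      omega
    · intro a ha b hb hle
      have h1 := (mem_below rk n a).1 ha
      have h2 := (mem_layer rk n b).1 hb
      have := hm.monotone hle
      omega

end ranked

/-- For a finite ranked poset `P`, gyration and rowmotion are conjugate in the toggle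
group: there is a bijection `g` of `J(P)` which is a finite composition of toggles such
that `gyr = g ∘ row ∘ g⁻¹`; in particular `J(P)` under `row` and under `gyr` are in
equivariant bijection. -/
theorem stmt_7 [Fintype P] (rk : P → ℕ) (hrk : ∀ p q : P, q ⋖ p → rk p = rk q + 1) :
    ∃ g : OrderIdeal P ≃ OrderIdeal P,
      (∃ l : List P, ⇑g = (l.map toggle).foldr (· ∘ ·) id) ∧
      gyration rk = ⇑g ∘ rowmotion ∘ ⇑g.symm := by
  obtain ⟨N, hN⟩ : ∃ N, ∀ x : P, rk x < N :=
    ⟨Finset.univ.sup rk + 1, fun x => Nat.lt_succ_of_le (Finset.le_sup (Finset.mem_univ x))⟩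
  obtain ⟨l, -, h⟩ := conj_main rk hrk N
  refine ⟨listPerm l, ⟨l, coe_listPerm l⟩, ?_⟩
  have hrow : (rowmotion : OrderIdeal P → OrderIdeal P) = ⇑(listPerm (below rk N)) := by
    funext I
    apply Subtype.ext
    ext x
    rw [listPerm_row I _ (below_pairwise rk hrk N)
      (fun x _ y _ => (mem_below rk N y).2 (hN y)), if_pos ((mem_below rk N x).2 (hN x))]
  have hg : gyration rk = ⇑(listPerm (parLt rk 1 N) * listPerm (parLt rk 0 N)) := by
    rw [Equiv.Perm.coe_mul, coe_listPerm, coe_listPerm]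
    simp only [gyration, parLt, hN, and_true]
  rw [hg, ← h, hrow]
  rfl
end

section
/- Let P be a finite ranked poset, p ∈ P with rk(p) even, and I ∈ J(P). If T_p(I) = 1, then either T_p(gyr(I)) = −1, or T_p(gyr(I)) = 0 and p ∈ gyr(I). If T_p(I) = −1, then either T_p(gyr(I)) = 1, or T_p(gyr(I)) = 0 and p ∉ gyr(I). -/
open scoped Classical

variable {P : Type*} [PartialOrder P]

theorem mem_toggle_of_ne {p q : P} (h : p ≠ q) (I : OrderIdeal P) :
    p ∈ (toggle q I).1 ↔ p ∈ I.1 := by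
  unfold toggle
  split_ifs <;> simp [h]

theorem mem_foldr_toggle {p : P} (L : List P) (h : p ∉ L) (I : OrderIdeal P) :
    p ∈ ((L.map toggle).foldr (· ∘ ·) id I).1 ↔ p ∈ I.1 := by
  induction L with
  | nil => simp
  | cons a L ih =>
    simp only [List.mem_cons, not_or] at h
    simp only [List.map_cons, List.foldr_cons, Function.comp_apply]
    rw [mem_toggle_of_ne h.1, ih h.2]

/-- `p` is a minimal element of the complement of `I`. -/
def CanAdd (p : P) (I : OrderIdeal P) : Prop := p ∉ I.1 ∧ ∀ q, q < p → q ∈ I.1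

/-- `p` is a maximal element of `I`. -/
def CanRemove (p : P) (I : OrderIdeal P) : Prop := p ∈ I.1 ∧ ∀ q, p < q → q ∉ I.1

theorem CanAdd.mem_toggle {p : P} {I : OrderIdeal P} (h : CanAdd p I) :
    p ∈ (toggle p I).1 := by
  unfold CanAdd at h
  unfold toggle
  rw [dif_pos h]
  simp

theorem CanRemove.notMem_toggle {p : P} {I : OrderIdeal P} (h : CanRemove p I) :
    p ∉ (toggle p I).1 := by
  unfold CanRemove at h
  unfold toggle
  rw [dif_neg (fun h' => h'.1 h.1), dif_pos h]
  simp

theorem CanAdd.toggle_of_ne {p q : P} {I : OrderIdeal P} (h : CanAdd p I) (hne : p ≠ q)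
    (hc : ¬ q ⋖ p) : CanAdd p (toggle q I) := by
  refine ⟨fun hm => h.1 ((mem_toggle_of_ne hne I).1 hm), fun r hr => ?_⟩
  by_cases hrq : r = q
  · subst hrq
    have hrI := h.2 r hr
    unfold toggle
    rw [dif_neg (fun h' => h'.1 hrI), dif_neg]
    · exact hrI
    · rintro ⟨-, h2⟩
      exact hc ⟨hr, fun x hx hxp => h2 x hx (h.2 x hxp)⟩
  · exact (mem_toggle_of_ne hrq I).2 (h.2 r hr)

theorem CanRemove.toggle_of_ne {p q : P} {I : OrderIdeal P} (h : CanRemove p I) (hne : p ≠ q)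
    (hc : ¬ p ⋖ q) : CanRemove p (toggle q I) := by
  refine ⟨(mem_toggle_of_ne hne I).2 h.1, fun r hr => ?_⟩
  by_cases hrq : r = q
  · subst hrq
    have hrI := h.2 r hr
    unfold toggle
    rw [dif_neg, dif_neg (fun h' => hrI h'.1)]
    · exact hrI
    · rintro ⟨-, h2⟩
      exact hc ⟨hr, fun x hx hxp => h.2 x hx (h2 x hxp)⟩
  · exact fun hm => h.2 r hr ((mem_toggle_of_ne hrq I).1 hm)

theorem CanAdd.foldr_toggle {p : P} {I : OrderIdeal P} (h : CanAdd p I) (L : List P)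
    (hp : p ∉ L) (hc : ∀ q ∈ L, ¬ q ⋖ p) :
    CanAdd p ((L.map toggle).foldr (· ∘ ·) id I) := by
  induction L with
  | nil => simpa using h
  | cons a L ih =>
    simp only [List.mem_cons, not_or, forall_eq_or_imp] at hp hc
    exact (ih hp.2 hc.2).toggle_of_ne hp.1 hc.1

theorem CanRemove.foldr_toggle {p : P} {I : OrderIdeal P} (h : CanRemove p I) (L : List P)
    (hp : p ∉ L) (hc : ∀ q ∈ L, ¬ p ⋖ q) :
    CanRemove p ((L.map toggle).foldr (· ∘ ·) id I) := by
  induction L with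
  | nil => simpa using h
  | cons a L ih =>
    simp only [List.mem_cons, not_or, forall_eq_or_imp] at hp hc
    exact (ih hp.2 hc.2).toggle_of_ne hp.1 hc.1

theorem CanAdd.mem_foldr {p : P} {I : OrderIdeal P} (h : CanAdd p I) (L : List P)
    (hn : L.Nodup) (hp : p ∈ L) (hc : ∀ q ∈ L, ¬ q ⋖ p) :
    p ∈ ((L.map toggle).foldr (· ∘ ·) id I).1 := by
  induction L with
  | nil => simp at hp
  | cons a L ih =>
    rw [List.nodup_cons] at hn
    by_cases hpa : p = a
    · subst hpa
      exact (h.foldr_toggle L hn.1 fun q hq => hc q (List.mem_cons_of_mem _ hq)).mem_toggle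
    · exact (mem_toggle_of_ne hpa _).2 (ih hn.2 ((List.mem_cons.1 hp).resolve_left hpa)
        fun q hq => hc q (List.mem_cons_of_mem _ hq))

theorem CanRemove.notMem_foldr {p : P} {I : OrderIdeal P} (h : CanRemove p I) (L : List P)
    (hn : L.Nodup) (hp : p ∈ L) (hc : ∀ q ∈ L, ¬ p ⋖ q) :
    p ∉ ((L.map toggle).foldr (· ∘ ·) id I).1 := by
  induction L with
  | nil => simp at hp
  | cons a L ih =>
    rw [List.nodup_cons] at hn
    by_cases hpa : p = a
    · subst hpa
      exact (h.foldr_toggle L hn.1 fun q hq => hc q (List.mem_cons_of_mem _ hq)).notMem_toggle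
    · exact fun hm => ih hn.2 ((List.mem_cons.1 hp).resolve_left hpa)
        (fun q hq => hc q (List.mem_cons_of_mem _ hq)) ((mem_toggle_of_ne hpa _).1 hm)

theorem togStat_of_mem {p : P} {I : OrderIdeal P} (h : p ∈ I.1) :
    togStat p I = -1 ∨ (togStat p I = 0 ∧ p ∈ I.1) := by
  unfold togStat
  rw [if_neg (fun h' => h'.1 h)]
  split_ifs <;> simp [h]

theorem togStat_of_notMem {p : P} {I : OrderIdeal P} (h : p ∉ I.1) :
    togStat p I = 1 ∨ (togStat p I = 0 ∧ p ∉ I.1) := by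
  unfold togStat
  split_ifs with h1 h2
  · simp
  · exact absurd h2.1 h
  · simp [h]

theorem canAdd_of_togStat {p : P} {I : OrderIdeal P} (h : togStat p I = 1) : CanAdd p I := by
  unfold togStat at h
  split_ifs at h with h1 h2
  · exact h1
  · simp at h

theorem canRemove_of_togStat {p : P} {I : OrderIdeal P} (h : togStat p I = -1) :
    CanRemove p I := by
  unfold togStat at h
  split_ifs at h with h1 h2
  exact h2

/-- Let `P` be a finite ranked poset, `p` of even rank, `I ∈ J(P)`.
If `T_p(I) = 1` then `T_p(gyr(I)) = -1`, or `T_p(gyr(I)) = 0` and `p ∈ gyr(I)`.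
If `T_p(I) = -1` then `T_p(gyr(I)) = 1`, or `T_p(gyr(I)) = 0` and `p ∉ gyr(I)`. -/
theorem stmt_9 [Fintype P] (rk : P → ℕ) (hrk : ∀ p q : P, q ⋖ p → rk p = rk q + 1)
    (p : P) (hp : rk p % 2 = 0) (I : OrderIdeal P) :
    (togStat p I = 1 →
      (togStat p (gyration rk I) = -1 ∨
        (togStat p (gyration rk I) = 0 ∧ p ∈ (gyration rk I).1))) ∧
    (togStat p I = -1 →
      (togStat p (gyration rk I) = 1 ∨
        (togStat p (gyration rk I) = 0 ∧ p ∉ (gyration rk I).1))) := by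
  have hodd : p ∉ (Finset.univ.filter fun p : P => rk p % 2 = 1).toList := by
    simp [hp]
  have hev : p ∈ (Finset.univ.filter fun p : P => rk p % 2 = 0).toList := by
    simp [hp]
  constructor
  · intro h
    apply togStat_of_mem
    refine (mem_foldr_toggle _ hodd _).2
      ((canAdd_of_togStat h).mem_foldr _ (Finset.nodup_toList _) hev fun q hq hc => ?_)
    have := hrk _ _ hc
    simp only [Finset.mem_toList, Finset.mem_filter] at hq
    omega
  · intro h
    apply togStat_of_notMem
    refine fun hm => (canRemove_of_togStat h).notMem_foldr _ (Finset.nodup_toList _) hev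
      (fun q hq hc => ?_) ((mem_foldr_toggle _ hodd _).1 hm)
    have := hrk _ _ hc
    simp only [Finset.mem_toList, Finset.mem_filter] at hq
    omega
end

section
/- For every n ≥ 1, the map sending an n×n alternating sign matrix (a_{i,j})_{1≤i,j≤n} to the (n+1)×(n+1) matrix (h_{i,j})_{0≤i,j≤n} defined by h_{i,j} = i + j − 2·Σ_{i'=1}^{i} Σ_{j'=1}^{j} a_{i',j'} is a bijection from the set of n×n alternating sign matrices to the set of height function matrices of order n. -/
open scoped Classical

/-- `a` is an `n × n` alternating sign matrix: entries in `{-1,0,1}`, all row and column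
sums equal to `1`, and the nonzero entries of each row and of each column alternate in
sign (any two consecutive nonzero entries of a row or column have opposite signs). -/
def IsASM (n : ℕ) (a : Fin n → Fin n → ℤ) : Prop :=
  (∀ i j, a i j = -1 ∨ a i j = 0 ∨ a i j = 1) ∧
  (∀ i, ∑ j, a i j = 1) ∧
  (∀ j, ∑ i, a i j = 1) ∧
  (∀ (i : Fin n) (j₁ j₂ : Fin n), j₁ < j₂ → a i j₁ ≠ 0 → a i j₂ ≠ 0 →
    (∀ j, j₁ < j → j < j₂ → a i j = 0) → a i j₂ = -a i j₁) ∧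
  (∀ (j : Fin n) (i₁ i₂ : Fin n), i₁ < i₂ → a i₁ j ≠ 0 → a i₂ j ≠ 0 →
    (∀ i, i₁ < i → i < i₂ → a i j = 0) → a i₂ j = -a i₁ j)

/-- A height function matrix of order `n`: an `(n+1) × (n+1)` integer matrix with
boundary `h 0 k = h k 0 = k`, `h n k = h k n = n - k`, whose entries adjacent in a row
or a column differ by exactly `1`. -/
def IsHeightFn (n : ℕ) (h : Fin (n + 1) → Fin (n + 1) → ℤ) : Prop :=
  (∀ k : Fin (n + 1), h 0 k = (k : ℤ) ∧ h k 0 = (k : ℤ) ∧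
    h (Fin.last n) k = (n : ℤ) - (k : ℤ) ∧ h k (Fin.last n) = (n : ℤ) - (k : ℤ)) ∧
  (∀ (i : Fin (n + 1)) (j : Fin n),
    h i j.castSucc - h i j.succ = 1 ∨ h i j.succ - h i j.castSucc = 1) ∧
  (∀ (i : Fin n) (j : Fin (n + 1)),
    h i.castSucc j - h i.succ j = 1 ∨ h i.succ j - h i.castSucc j = 1)

/-- The map sending an `n × n` matrix `a` (rows and columns indexed `1, …, n` by `Fin n`)
to the `(n+1) × (n+1)` matrix `h i j = i + j - 2 ∑_{i'=1}^{i} ∑_{j'=1}^{j} a i' j'`. -/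
def asmToHeight (n : ℕ) (a : Fin n → Fin n → ℤ) (i j : Fin (n + 1)) : ℤ :=
  (i : ℤ) + (j : ℤ) -
    2 * ∑ i' : Fin n, ∑ j' : Fin n,
      if (i' : ℕ) < (i : ℕ) ∧ (j' : ℕ) < (j : ℕ) then a i' j' else 0

/-- Partial sums of a finite sequence. -/
def psum {n : ℕ} (f : Fin n → ℤ) (k : ℕ) : ℤ := ∑ j : Fin n, if (j : ℕ) < k then f j else 0

lemma psum_zero {n : ℕ} (f : Fin n → ℤ) : psum f 0 = 0 := by simp [psum]

lemma psum_succ {n : ℕ} (f : Fin n → ℤ) (k : Fin n) :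
    psum f ((k : ℕ) + 1) = psum f k + f k := by
  have h : f k = ∑ j : Fin n, if j = k then f j else 0 := by simp
  unfold psum
  conv_rhs => rw [h]
  rw [← Finset.sum_add_distrib]
  refine Finset.sum_congr rfl fun j _ => ?_
  by_cases h1 : j = k
  · subst h1; simp
  · have h2 : (j : ℕ) ≠ k := fun h => h1 (Fin.ext h)
    by_cases h3 : (j : ℕ) < k
    · simp [h1, h3, Nat.lt_succ_of_lt h3]
    · have : ¬ (j : ℕ) < k + 1 := by omega
      simp only [h1, h3, this]; simp

lemma psum_all {n : ℕ} (f : Fin n → ℤ) : psum f n = ∑ j, f j := by simp [psum]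

/-- One-dimensional alternating condition. -/
def Alt {n : ℕ} (f : Fin n → ℤ) : Prop :=
  ∀ j₁ j₂ : Fin n, j₁ < j₂ → f j₁ ≠ 0 → f j₂ ≠ 0 →
    (∀ j, j₁ < j → j < j₂ → f j = 0) → f j₂ = -f j₁

/-- State: last nonzero entry before `k` is `f j`, and `psum` is `c` after a `1`,
`c - 1` after a `-1`. -/
def St {n : ℕ} (f : Fin n → ℤ) (c : ℤ) (k : ℕ) : Prop :=
  ∃ j : Fin n, (j : ℕ) < k ∧ (∀ i : Fin n, j < i → (i : ℕ) < k → f i = 0) ∧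
    ((f j = 1 ∧ psum f k = c) ∨ (f j = -1 ∧ psum f k = c - 1))

lemma St_succ {n : ℕ} {f : Fin n → ℤ} (he : ∀ j, f j = -1 ∨ f j = 0 ∨ f j = 1) (ha : Alt f)
    {c : ℤ} (k : Fin n) (h : St f c k) : St f c (k + 1) := by
  obtain ⟨j, hj, hz, hs⟩ := h
  have hp := psum_succ f k
  by_cases h0 : f k = 0
  · refine ⟨j, by omega, fun i hi hik => ?_, ?_⟩
    · by_cases hik' : i = k
      · rw [hik']; exact h0
      · exact hz i hi (by have : (i : ℕ) ≠ k := fun h => hik' (Fin.ext h)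
                          omega)
    · rw [hp, h0, add_zero]; exact hs
  · have hneg := ha j k hj (by rcases hs with h | h <;> simp [h.1]) h0
      (fun i h1 h2 => hz i h1 h2)
    refine ⟨k, by omega, fun i hi hik => ?_, ?_⟩
    · have : (k : ℕ) < i := hi
      omega
    · rw [hp]; omega

lemma St_mono {n : ℕ} {f : Fin n → ℤ} (he : ∀ j, f j = -1 ∨ f j = 0 ∨ f j = 1) (ha : Alt f)
    {c : ℤ} {k : ℕ} (h : St f c k) (m : ℕ) (hkm : k ≤ m) (hm : m ≤ n) : St f c m := by
  induction m, hkm using Nat.le_induction with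
  | base => exact h
  | succ m _ ih => exact St_succ he ha ⟨m, by omega⟩ (ih (by omega))

lemma St_cases {n : ℕ} {f : Fin n → ℤ} (he : ∀ j, f j = -1 ∨ f j = 0 ∨ f j = 1) (ha : Alt f)
    (k : ℕ) (hk : k ≤ n) :
    ((∀ j : Fin n, (j : ℕ) < k → f j = 0) ∧ psum f k = 0) ∨ St f 1 k ∨ St f 0 k := by
  induction k with
  | zero => left; simp [psum_zero]
  | succ k ih =>
    have hp := psum_succ f ⟨k, by omega⟩
    simp only at hp
    rcases ih (by omega) with ⟨hz, h0⟩ | h | h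
    · have hlast : ∀ i : Fin n, (⟨k, by omega⟩ : Fin n) < i → (i : ℕ) < k + 1 → f i = 0 := by
        intro i hi hik
        have : k < (i : ℕ) := hi
        omega
      rcases he ⟨k, by omega⟩ with h | h | h
      · right; right
        exact ⟨⟨k, by omega⟩, by simp, hlast, Or.inr ⟨h, by omega⟩⟩
      · left
        refine ⟨fun j hj => ?_, by omega⟩
        rcases Nat.lt_succ_iff_lt_or_eq.1 hj with h' | h'
        · exact hz j h'
        · rw [← h]; congr 1; exact Fin.ext h'
      · right; left
        exact ⟨⟨k, by omega⟩, by simp, hlast, Or.inl ⟨h, by omega⟩⟩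
    · right; left; exact St_succ he ha ⟨k, by omega⟩ h
    · right; right; exact St_succ he ha ⟨k, by omega⟩ h

lemma psum_mem {n : ℕ} {f : Fin n → ℤ} (he : ∀ j, f j = -1 ∨ f j = 0 ∨ f j = 1) (ha : Alt f)
    (h1 : ∑ j, f j = 1) (k : ℕ) (hk : k ≤ n) : psum f k = 0 ∨ psum f k = 1 := by
  rcases St_cases he ha k hk with h | h | h
  · exact Or.inl h.2
  · obtain ⟨j, _, _, h⟩ := h
    omega
  · obtain ⟨j, _, _, h⟩ := St_mono he ha h n hk le_rfl
    rw [psum_all, h1] at h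
    omega

lemma alt_of_psum {n : ℕ} {f : Fin n → ℤ} (h : ∀ k ≤ n, psum f k = 0 ∨ psum f k = 1) :
    (∀ j, f j = -1 ∨ f j = 0 ∨ f j = 1) ∧ Alt f := by
  constructor
  · intro j
    have := psum_succ f j
    have := h j (by omega)
    have := h (j + 1) (by omega)
    omega
  · intro j₁ j₂ hlt h1 h2 hz
    have hlt' : (j₁ : ℕ) < j₂ := hlt
    have key : ∀ m : ℕ, (j₁ : ℕ) + 1 ≤ m → m ≤ j₂ → psum f m = psum f (j₁ + 1) := by
      intro m hm
      induction m, hm using Nat.le_induction with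
      | base => intro _; rfl
      | succ m hm ih =>
        intro hm2
        have hp := psum_succ f ⟨m, by omega⟩
        simp only at hp
        rw [hp, ih (by omega), hz ⟨m, by omega⟩ (Fin.lt_def.2 (by simp; omega))
          (Fin.lt_def.2 (by simp; omega)), add_zero]
    have k1 := key j₂ (by omega) le_rfl
    have := psum_succ f j₁
    have := psum_succ f j₂
    have := h j₁ (by omega)
    have := h (j₁ + 1) (by omega)
    have := h (j₂ + 1) (by omega)
    omega

/-- Corner sums. -/
def csum {n : ℕ} (a : Fin n → Fin n → ℤ) (i j : ℕ) : ℤ := psum (fun i' => psum (a i') j) i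

lemma csum_eq {n : ℕ} (a : Fin n → Fin n → ℤ) (i j : ℕ) :
    csum a i j = ∑ i' : Fin n, ∑ j' : Fin n,
      if (i' : ℕ) < i ∧ (j' : ℕ) < j then a i' j' else 0 := by
  unfold csum psum
  refine Finset.sum_congr rfl fun i' _ => ?_
  by_cases h : (i' : ℕ) < i <;> simp [h]

lemma csum_swap {n : ℕ} (a : Fin n → Fin n → ℤ) (i j : ℕ) :
    csum a i j = csum (fun x y => a y x) j i := by
  rw [csum_eq, csum_eq, Finset.sum_comm]
  simp only [and_comm]

lemma csum_row {n : ℕ} (a : Fin n → Fin n → ℤ) (i : Fin n) (j : ℕ) :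
    csum a (i + 1) j = csum a i j + psum (a i) j := psum_succ _ i

lemma csum_col {n : ℕ} (a : Fin n → Fin n → ℤ) (i : ℕ) (j : Fin n) :
    csum a i (j + 1) = csum a i j + psum (fun x => a x j) i := by
  rw [csum_swap, csum_swap a i j]; exact csum_row _ j i

lemma height_eq {n : ℕ} (a : Fin n → Fin n → ℤ) (i j : Fin (n + 1)) :
    asmToHeight n a i j = (i : ℤ) + j - 2 * csum a i j := by
  rw [csum_eq]; rfl

lemma csum_zero_left {n : ℕ} (a : Fin n → Fin n → ℤ) (j : ℕ) : csum a 0 j = 0 := psum_zero _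

lemma csum_zero_right {n : ℕ} (a : Fin n → Fin n → ℤ) (i : ℕ) : csum a i 0 = 0 := by
  rw [csum_swap, csum_zero_left]

lemma csum_full {n : ℕ} (a : Fin n → Fin n → ℤ) (h : ∀ i, ∑ j, a i j = 1) (i : ℕ) (hi : i ≤ n) :
    csum a i n = i := by
  induction i with
  | zero => simp [csum_zero_left]
  | succ i ih =>
    have := csum_row a ⟨i, by omega⟩ n
    simp only at this
    rw [this, ih (by omega), psum_all, h]; simp

lemma isASM_iff {n : ℕ} (a : Fin n → Fin n → ℤ) :
    IsASM n a ↔ IsHeightFn n (asmToHeight n a) := by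
  constructor
  · rintro ⟨he, hr, hc, har, hac⟩
    refine ⟨fun k => ?_, fun i j => ?_, fun i j => ?_⟩
    · have hk : (k : ℕ) ≤ n := by omega
      have h1 := csum_full a hr k hk
      have h2 := csum_full (fun x y => a y x) hc k hk
      rw [← csum_swap] at h2
      simp only [height_eq, Fin.val_zero, Fin.val_last, csum_zero_left, csum_zero_right, h1, h2]
      refine ⟨?_, ?_, ?_, ?_⟩ <;> push_cast <;> ring
    · have h1 := psum_mem (f := fun x => a x j) (fun x => he x j) (hac j) (hc j) i (by omega)
      have h2 := csum_col a i j
      simp only [height_eq, Fin.val_castSucc, Fin.val_succ]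
      push_cast
      omega
    · have h1 := psum_mem (f := a i) (he i) (har i) (hr i) j (by omega)
      have h2 := csum_row a i j
      simp only [height_eq, Fin.val_castSucc, Fin.val_succ]
      push_cast
      omega
  · rintro ⟨hb, hcol, hrow⟩
    have hr : ∀ i : Fin n, ∀ k ≤ n, psum (a i) k = 0 ∨ psum (a i) k = 1 := by
      intro i k hk
      have h1 := hrow i ⟨k, by omega⟩
      have h2 := csum_row a i k
      simp only [height_eq, Fin.val_castSucc, Fin.val_succ] at h1
      push_cast at h1
      omega
    have hc : ∀ j : Fin n, ∀ k ≤ n, psum (fun x => a x j) k = 0 ∨ psum (fun x => a x j) k = 1 := by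
      intro j k hk
      have h1 := hcol ⟨k, by omega⟩ j
      have h2 := csum_col a k j
      simp only [height_eq, Fin.val_castSucc, Fin.val_succ] at h1
      push_cast at h1
      omega
    refine ⟨fun i => (alt_of_psum (hr i)).1, fun i => ?_, fun j => ?_,
      fun i => (alt_of_psum (hr i)).2, fun j => (alt_of_psum (hc j)).2⟩
    · have h1 := (hb i.castSucc).2.2.2
      have h2 := (hb i.succ).2.2.2
      have h3 := csum_row a i n
      simp only [height_eq, Fin.val_castSucc, Fin.val_succ, Fin.val_last] at h1 h2
      push_cast at h1 h2
      rw [psum_all] at h3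
      omega
    · have h1 := (hb j.castSucc).2.2.1
      have h2 := (hb j.succ).2.2.1
      have h3 := csum_col a n j
      simp only [height_eq, Fin.val_castSucc, Fin.val_succ, Fin.val_last] at h1 h2
      push_cast at h1 h2
      rw [psum_all] at h3
      omega

lemma asmToHeight_injective (n : ℕ) : Function.Injective (asmToHeight n) := by
  intro a b hab
  have hC : ∀ i j : ℕ, i ≤ n → j ≤ n → csum a i j = csum b i j := by
    intro i j hi hj
    have := congrFun (congrFun hab ⟨i, by omega⟩) ⟨j, by omega⟩
    simp only [height_eq] at this
    omega
  have hP : ∀ (i : Fin n) (j : ℕ), j ≤ n → psum (a i) j = psum (b i) j := by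
    intro i j hj
    have := csum_row a i j
    have := csum_row b i j
    have := hC i j (by omega) hj
    have := hC (i + 1) j (by omega) hj
    omega
  funext i j
  have := psum_succ (a i) j
  have := psum_succ (b i) j
  have := hP i j (by omega)
  have := hP i (j + 1) (by omega)
  omega

lemma exists_preimage {n : ℕ} (h : Fin (n + 1) → Fin (n + 1) → ℤ) (hh : IsHeightFn n h) :
    ∃ a, asmToHeight n a = h := by
  obtain ⟨hb, hcol, hrow⟩ := hh
  let a : Fin n → Fin n → ℤ := fun i j =>
    (h i.castSucc j.succ + h i.succ j.castSucc - h i.succ j.succ - h i.castSucc j.castSucc) / 2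
  have ha : ∀ i j, 2 * a i j =
      h i.castSucc j.succ + h i.succ j.castSucc - h i.succ j.succ - h i.castSucc j.castSucc := by
    intro i j
    have h1 := hcol i.castSucc j
    have h2 := hcol i.succ j
    simp only [a]
    omega
  have hP : ∀ (i : Fin n) (j : Fin (n + 1)),
      2 * psum (a i) j = 1 - (h i.succ j - h i.castSucc j) := by
    intro i j
    induction j using Fin.induction with
    | zero =>
      have h1 := (hb i.castSucc).2.1
      have h2 := (hb i.succ).2.1
      simp only [Fin.val_castSucc, Fin.val_succ] at h1 h2
      rw [h1, h2, Fin.val_zero, psum_zero]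
      push_cast; ring
    | succ j ih =>
      have h1 := psum_succ (a i) j
      have h2 := ha i j
      simp only [Fin.val_castSucc, Fin.val_succ] at ih ⊢
      omega
  refine ⟨a, ?_⟩
  funext i j
  rw [height_eq]
  induction i using Fin.induction with
  | zero =>
    rw [(hb j).1, Fin.val_zero, csum_zero_left]; simp
  | succ i ih =>
    have h1 := csum_row a i j
    have h2 := hP i j
    simp only [Fin.val_castSucc, Fin.val_succ] at ih ⊢
    push_cast
    omega

/-- For every `n ≥ 1`, the map `a ↦ (i + j - 2 ∑_{i'≤i} ∑_{j'≤j} a i' j')` is a bijection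
from the set of `n × n` alternating sign matrices onto the set of height function
matrices of order `n`. -/
theorem stmt_15 (n : ℕ) (hn : 1 ≤ n) :
    Set.BijOn (asmToHeight n) {a | IsASM n a} {h | IsHeightFn n h} := by
  refine ⟨fun a ha => (isASM_iff a).1 ha, (asmToHeight_injective n).injOn, fun h hh => ?_⟩
  obtain ⟨a, rfl⟩ := exists_preimage h hh
  exact ⟨a, (isASM_iff a).2 hh, rfl⟩
end

section
/- For every n ≥ 1, the following map is a bijection from the set of height function matrices of order n to the set of fully-packed loop configurations of order n: given a height function matrix h, include the horizontal internal edge between vertices (i,j) and (i,j+1) if and only if the vertically adjacent entries h_{i−1,j} and h_{i,j} are {2k−1, 2k} for some integer k, and include the vertical internal edge between vertices (i,j) and (i+1,j) if and only if the horizontally adjacent entries h_{i,j−1} and h_{i,j} are {2k, 2k+1} for some integer k. -/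
open scoped Classical

/-- The number of fixed external half-edges at the vertex `(i,j)` of the `n × n` grid
(1-indexed, `i` the row from the top, `j` the column from the left): an upward edge at
`(1,j)` for odd `j`; a rightward edge at `(i,n)` for `n - i` odd; a downward edge at
`(n,j)` for `n - j` even; a leftward edge at `(i,1)` for even `i`. -/
def extCount (n i j : ℕ) : ℕ :=
  (if i = 1 ∧ j % 2 = 1 then 1 else 0) +
  (if j = n ∧ (n - i) % 2 = 1 then 1 else 0) +
  (if i = n ∧ (n - j) % 2 = 0 then 1 else 0) +
  (if j = 1 ∧ i % 2 = 0 then 1 else 0)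

/-- A fully-packed loop configuration of order `n`, encoded by its internal edges:
`H i j` indicates the horizontal edge between vertices `(i,j)` and `(i,j+1)`
(for `1 ≤ i ≤ n`, `1 ≤ j ≤ n-1`), and `V i j` indicates the vertical edge between
vertices `(i,j)` and `(i+1,j)` (for `1 ≤ i ≤ n-1`, `1 ≤ j ≤ n`). The condition is that
every vertex of the grid is incident to exactly two edges, counting the fixed external
half-edges. -/
def IsFPL (n : ℕ) (H V : ℕ → ℕ → Bool) : Prop :=
  (∀ i j, H i j = true → 1 ≤ i ∧ i ≤ n ∧ 1 ≤ j ∧ j + 1 ≤ n) ∧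
  (∀ i j, V i j = true → 1 ≤ i ∧ i + 1 ≤ n ∧ 1 ≤ j ∧ j ≤ n) ∧
  (∀ i j, 1 ≤ i → i ≤ n → 1 ≤ j → j ≤ n →
    (if H i j then 1 else 0) + (if H i (j - 1) then 1 else 0) +
      (if V i j then 1 else 0) + (if V (i - 1) j then 1 else 0) + extCount n i j = 2)

/-- The map from height function matrices of order `n` to edge configurations on the
`n × n` grid: the vertex `(i,j)` lies among the four height entries `h (i-1) (j-1)`,
`h (i-1) j`, `h i (j-1)`, `h i j`; the horizontal edge between `(i,j)` and `(i,j+1)` is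
included iff the vertically adjacent entries `h (i-1) j` and `h i j` are `{2k-1, 2k}`
for some integer `k`, and the vertical edge between `(i,j)` and `(i+1,j)` is included
iff the horizontally adjacent entries `h i (j-1)` and `h i j` are `{2k, 2k+1}` for some
integer `k`. -/
noncomputable def heightToFPL (n : ℕ) (h : Fin (n + 1) → Fin (n + 1) → ℤ) :
    (ℕ → ℕ → Bool) × (ℕ → ℕ → Bool) :=
  let hv : ℕ → ℕ → ℤ := fun a b =>
    if ha : a < n + 1 then if hb : b < n + 1 then h ⟨a, ha⟩ ⟨b, hb⟩ else 0 else 0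
  (fun i j => decide (1 ≤ i ∧ i ≤ n ∧ 1 ≤ j ∧ j + 1 ≤ n ∧
      ∃ k : ℤ, (hv (i - 1) j = 2 * k - 1 ∧ hv i j = 2 * k) ∨
        (hv (i - 1) j = 2 * k ∧ hv i j = 2 * k - 1)),
   fun i j => decide (1 ≤ i ∧ i + 1 ≤ n ∧ 1 ≤ j ∧ j ≤ n ∧
      ∃ k : ℤ, (hv i (j - 1) = 2 * k ∧ hv i j = 2 * k + 1) ∨
        (hv i (j - 1) = 2 * k + 1 ∧ hv i j = 2 * k)))

/-- The height matrix extended by zero to all of `ℕ × ℕ`. -/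
def extH (n : ℕ) (h : Fin (n + 1) → Fin (n + 1) → ℤ) (a b : ℕ) : ℤ :=
  if ha : a < n + 1 then if hb : b < n + 1 then h ⟨a, ha⟩ ⟨b, hb⟩ else 0 else 0

/-- Checkerboard sign. -/
def sgn (m : ℕ) : ℤ := if m % 2 = 0 then 1 else -1

/-- Horizontal edge indicator including external edges. -/
noncomputable def hx (n : ℕ) (H : ℕ → ℕ → Bool) (i j : ℕ) : ℤ :=
  (if H i j then 1 else 0) + (if j = 0 ∧ i % 2 = 0 then 1 else 0) +
    (if j = n ∧ (n - i) % 2 = 1 then 1 else 0)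

/-- Vertical edge indicator including external edges. -/
noncomputable def vx (n : ℕ) (V : ℕ → ℕ → Bool) (i j : ℕ) : ℤ :=
  (if V i j then 1 else 0) + (if i = 0 ∧ j % 2 = 1 then 1 else 0) +
    (if i = n ∧ (n - j) % 2 = 0 then 1 else 0)

/-- Height functions on natural-number indices. -/
structure NatHt (n : ℕ) (g : ℕ → ℕ → ℤ) : Prop where
  top : ∀ k ≤ n, g 0 k = k
  left : ∀ k ≤ n, g k 0 = k
  bot : ∀ k ≤ n, g n k = n - k
  right : ∀ k ≤ n, g k n = n - k
  row : ∀ i ≤ n, ∀ j < n, g i j - g i (j+1) = 1 ∨ g i (j+1) - g i j = 1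
  col : ∀ i < n, ∀ j ≤ n, g i j - g (i+1) j = 1 ∨ g (i+1) j - g i j = 1

lemma extH_eq {n : ℕ} (h : Fin (n + 1) → Fin (n + 1) → ℤ) (i j : Fin (n+1)) :
    extH n h i j = h i j := by
  simp [extH, i.2, j.2]

lemma natHt_of {n : ℕ} {h : Fin (n + 1) → Fin (n + 1) → ℤ} (hh : IsHeightFn n h) :
    NatHt n (extH n h) := by
  obtain ⟨h1, h2, h3⟩ := hh
  constructor
  · intro k hk
    rw [← (h1 ⟨k, by omega⟩).1, ← extH_eq h]; rfl
  · intro k hk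
    rw [← (h1 ⟨k, by omega⟩).2.1, ← extH_eq h]; rfl
  · intro k hk
    have := (h1 ⟨k, by omega⟩).2.2.1
    rw [← extH_eq h] at this; exact this
  · intro k hk
    have := (h1 ⟨k, by omega⟩).2.2.2
    rw [← extH_eq h] at this; exact this
  · intro i hi j hj
    have := h2 ⟨i, by omega⟩ ⟨j, hj⟩
    rw [← extH_eq h, ← extH_eq h] at this; exact this
  · intro i hi j hj
    have := h3 ⟨i, hi⟩ ⟨j, by omega⟩
    rw [← extH_eq h, ← extH_eq h] at this; exact this

lemma isHeightFn_of {n : ℕ} {g : ℕ → ℕ → ℤ} (hg : NatHt n g) :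
    IsHeightFn n (fun i j => g i j) := by
  refine ⟨fun k => ⟨?_, ?_, ?_, ?_⟩, fun i j => ?_, fun i j => ?_⟩
  · exact hg.top k (by omega)
  · exact hg.left k (by omega)
  · exact hg.bot k (by omega)
  · exact hg.right k (by omega)
  · exact hg.row i (by omega) j (by omega)
  · exact hg.col i (by omega) j (by omega)

lemma NatHt.parity {n : ℕ} {g : ℕ → ℕ → ℤ} (hg : NatHt n g) (i : ℕ) (hi : i ≤ n) (j : ℕ)
    (hj : j ≤ n) : (g i j - (i + j)) % 2 = 0 := by
  induction j with
  | zero => have := hg.left i hi; simp [this]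
  | succ j ih =>
    have h1 := ih (by omega)
    have h2 := hg.row i hi j (by omega)
    push_cast
    omega

lemma exV {a b : ℤ} : (∃ k : ℤ, (a = 2 * k ∧ b = 2 * k + 1) ∨ (a = 2 * k + 1 ∧ b = 2 * k)) ↔
    (a % 2 = 0 ∧ b = a + 1) ∨ (a % 2 = 1 ∧ b = a - 1) := by
  constructor
  · rintro ⟨k, hk⟩; omega
  · intro h; exact ⟨a / 2, by omega⟩

lemma exH {a b : ℤ} : (∃ k : ℤ, (a = 2 * k - 1 ∧ b = 2 * k) ∨ (a = 2 * k ∧ b = 2 * k - 1)) ↔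
    (a % 2 = 0 ∧ b = a - 1) ∨ (a % 2 = 1 ∧ b = a + 1) := by
  constructor
  · rintro ⟨k, hk⟩; omega
  · intro h; exact ⟨(a + 1) / 2, by omega⟩

lemma map_H (n : ℕ) (h : Fin (n + 1) → Fin (n + 1) → ℤ) (i j : ℕ) :
    (heightToFPL n h).1 i j = true ↔ (1 ≤ i ∧ i ≤ n ∧ 1 ≤ j ∧ j + 1 ≤ n ∧
      ((extH n h (i-1) j % 2 = 0 ∧ extH n h i j = extH n h (i-1) j - 1) ∨
       (extH n h (i-1) j % 2 = 1 ∧ extH n h i j = extH n h (i-1) j + 1))) := by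
  rw [← exH]
  simp only [heightToFPL, extH, decide_eq_true_eq]

lemma map_V (n : ℕ) (h : Fin (n + 1) → Fin (n + 1) → ℤ) (i j : ℕ) :
    (heightToFPL n h).2 i j = true ↔ (1 ≤ i ∧ i + 1 ≤ n ∧ 1 ≤ j ∧ j ≤ n ∧
      ((extH n h i (j-1) % 2 = 0 ∧ extH n h i j = extH n h i (j-1) + 1) ∨
       (extH n h i (j-1) % 2 = 1 ∧ extH n h i j = extH n h i (j-1) - 1))) := by
  rw [← exV]
  simp only [heightToFPL, extH, decide_eq_true_eq]

/-- horizontal steps of the heights versus vertical edges -/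
lemma keyV {n : ℕ} (hn : 1 ≤ n) {h : Fin (n + 1) → Fin (n + 1) → ℤ} (hh : IsHeightFn n h)
    (i j : ℕ) (hi : i ≤ n) (hj : j < n) :
    extH n h i (j+1) - extH n h i j = sgn (i + j + 1) * (1 - 2 * vx n (heightToFPL n h).2 i (j+1)) := by
  have hg := natHt_of hh
  have hp := hg.parity i hi j hj.le
  have hr := hg.row i hi j hj
  have t1 := hg.top j hj.le
  have t2 := hg.top (j+1) hj
  have b1 := hg.bot j hj.le
  have b2 := hg.bot (j+1) hj
  have hm := map_V n h i (j+1)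
  simp only [Nat.add_sub_cancel] at hm
  unfold vx sgn
  simp only [hm]
  clear hm
  rcases Nat.eq_zero_or_pos i with rfl | hi0
  · rw [t1, t2]; push_cast
    clear b1 b2 hr hp
    simp only [true_and, false_and, and_false, if_false]
    split_ifs <;> omega
  rcases hi.eq_or_lt with rfl | hin
  · rw [b1, b2]; push_cast
    split_ifs <;> omega
  generalize extH n h i (j+1) = b at *
  generalize extH n h i j = a at *
  split_ifs <;> omega

lemma keyH {n : ℕ} (hn : 1 ≤ n) {h : Fin (n + 1) → Fin (n + 1) → ℤ} (hh : IsHeightFn n h)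
    (i j : ℕ) (hi : i < n) (hj : j ≤ n) :
    extH n h (i+1) j - extH n h i j = sgn (i + 1 + j) * (2 * hx n (heightToFPL n h).1 (i+1) j - 1) := by
  have hg := natHt_of hh
  have hp := hg.parity i hi.le j hj
  have hr := hg.col i hi j hj
  have t1 := hg.left i hi.le
  have t2 := hg.left (i+1) hi
  have b1 := hg.right i hi.le
  have b2 := hg.right (i+1) hi
  have hm := map_H n h (i+1) j
  simp only [Nat.add_sub_cancel] at hm
  unfold hx sgn
  simp only [hm]
  clear hm
  rcases Nat.eq_zero_or_pos j with rfl | hj0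
  · rw [t1, t2]; push_cast
    clear b1 b2 hr hp
    simp only [true_and, false_and, and_false, if_false]
    split_ifs <;> omega
  rcases hj.eq_or_lt with rfl | hjn
  · rw [b1, b2]; push_cast
    split_ifs <;> omega
  generalize extH n h (i+1) j = b at *
  generalize extH n h i j = a at *
  split_ifs <;> omega

/-- The vertex condition in terms of the extended indicators. -/
lemma vertex_iff {n : ℕ} (H V : ℕ → ℕ → Bool) (i j : ℕ) (hi : i < n) (hj : j < n) :
    ((if H (i+1) (j+1) then 1 else 0) + (if H (i+1) (j+1-1) then 1 else 0) +
      (if V (i+1) (j+1) then 1 else 0) + (if V (i+1-1) (j+1) then 1 else 0)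
        + extCount n (i+1) (j+1) = 2) ↔
    hx n H (i+1) (j+1) + hx n H (i+1) j + vx n V (i+1) (j+1) + vx n V i (j+1) = 2 := by
  unfold hx vx extCount
  simp only [Nat.add_sub_cancel]
  have e1 : ¬ (j + 1 = 0) := by omega
  have e2 : ¬ (j = n) := by omega
  have e3 : ¬ (i + 1 = 0) := by omega
  have e4 : ¬ (i = n) := by omega
  have e5 : i + 1 = 1 ↔ i = 0 := by omega
  have e6 : j + 1 = 1 ↔ j = 0 := by omega
  simp only [e1, e2, e3, e4, e5, e6, false_and, if_false]
  rw [← Nat.cast_inj (R := ℤ)]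
  push_cast
  constructor <;> intro h <;> linarith

lemma sgn_succ (m : ℕ) : sgn (m + 1) = - sgn m := by
  unfold sgn; split_ifs <;> omega

lemma sgn_cases (m : ℕ) : sgn m = 1 ∨ sgn m = -1 := by
  unfold sgn; split_ifs <;> simp

lemma fpl_mapsTo {n : ℕ} (hn : 1 ≤ n) {h : Fin (n + 1) → Fin (n + 1) → ℤ} (hh : IsHeightFn n h) :
    IsFPL n (heightToFPL n h).1 (heightToFPL n h).2 := by
  refine ⟨fun i j hij => ?_, fun i j hij => ?_, fun i j hi hin hj hjn => ?_⟩
  · rw [map_H] at hij; omega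
  · rw [map_V] at hij; omega
  · obtain ⟨i, rfl⟩ := Nat.exists_eq_add_of_le' hi
    obtain ⟨j, rfl⟩ := Nat.exists_eq_add_of_le' hj
    rw [vertex_iff _ _ i j hin hjn]
    have k1 := keyV hn hh i j (by omega) (by omega)
    have k2 := keyV hn hh (i+1) j (by omega) (by omega)
    have k3 := keyH hn hh i j (by omega) (by omega)
    have k4 := keyH hn hh i (j+1) (by omega) (by omega)
    rw [show i + 1 + j + 1 = i + j + 1 + 1 by ring, sgn_succ] at k2
    rw [show i + 1 + j = i + j + 1 by ring] at k3
    rw [show i + 1 + (j + 1) = i + j + 1 + 1 by ring, sgn_succ] at k4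
    rcases sgn_cases (i + j + 1) with hs | hs <;> rw [hs] at k1 k2 k3 k4 <;> linarith

lemma fpl_inj {n : ℕ} (hn : 1 ≤ n) {h hB2 : Fin (n + 1) → Fin (n + 1) → ℤ} (hh : IsHeightFn n h)
    (hh2 : IsHeightFn n hB2) (he : heightToFPL n h = heightToFPL n hB2) : h = hB2 := by
  have key : ∀ i ≤ n, ∀ j, j ≤ n → extH n h i j = extH n hB2 i j := by
    intro i hi j
    induction j with
    | zero => intro _; rw [(natHt_of hh).left i hi, (natHt_of hh2).left i hi]
    | succ j ih =>
      intro hj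
      have k1 := keyV hn hh i j hi hj
      have k2 := keyV hn hh2 i j hi hj
      rw [← he] at k2
      linarith [ih (by omega)]
  funext i j
  rw [← extH_eq h, ← extH_eq hB2]
  exact key i (by omega) j (by omega)

/-- The height built from an FPL. -/
noncomputable def gOf (n : ℕ) (V : ℕ → ℕ → Bool) (i : ℕ) : ℕ → ℤ
  | 0 => i
  | j + 1 => gOf n V i j + sgn (i + j + 1) * (1 - 2 * vx n V i (j+1))

lemma vx_cases {n : ℕ} (hn : 1 ≤ n) {H V : ℕ → ℕ → Bool} (hF : IsFPL n H V) (i j : ℕ) :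
    vx n V i j = 0 ∨ vx n V i j = 1 := by
  have := hF.2.1 i j
  unfold vx
  split_ifs <;> first | omega | simp_all

lemma hx_cases {n : ℕ} (hn : 1 ≤ n) {H V : ℕ → ℕ → Bool} (hF : IsFPL n H V) (i j : ℕ) :
    hx n H i j = 0 ∨ hx n H i j = 1 := by
  have := hF.1 i j
  unfold hx
  split_ifs <;> first | omega | simp_all

lemma gOf_col {n : ℕ} (hn : 1 ≤ n) {H V : ℕ → ℕ → Bool} (hF : IsFPL n H V) (i : ℕ) (hi : i < n)
    (j : ℕ) (hj : j ≤ n) :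
    gOf n V (i+1) j - gOf n V i j = sgn (i + 1 + j) * (2 * hx n H (i+1) j - 1) := by
  induction j with
  | zero =>
    have hH : H (i+1) 0 = false := by
      by_contra hc
      have := hF.1 (i+1) 0 (by simpa using hc)
      omega
    simp only [gOf, hx, sgn, hH]
    push_cast
    split_ifs <;> simp_all <;> omega
  | succ j ih =>
    have ih := ih (by omega)
    have hv := (vertex_iff H V i j hi hj).1 (hF.2.2 (i+1) (j+1) (by omega) hi (by omega) hj)
    simp only [gOf]
    rw [show i + 1 + j + 1 = i + j + 1 + 1 by ring,
      show i + 1 + (j + 1) = i + j + 1 + 1 by ring, sgn_succ (i + j + 1)]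
    rw [show i + 1 + j = i + j + 1 by ring] at ih
    rcases sgn_cases (i + j + 1) with hs | hs <;> rw [hs] at ih ⊢ <;> linarith

lemma natHt_gOf {n : ℕ} (hn : 1 ≤ n) {H V : ℕ → ℕ → Bool} (hF : IsFPL n H V) :
    NatHt n (gOf n V) := by
  have htop : ∀ k ≤ n, gOf n V 0 k = k := by
    intro k
    induction k with
    | zero => intro _; simp [gOf]
    | succ k ih =>
      intro hk
      have hV : V 0 (k+1) = false := by
        by_contra hc
        have := hF.2.1 0 (k+1) (by simpa using hc)
        omega
      rw [gOf, ih (by omega)]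
      simp only [vx, sgn, hV]
      push_cast
      split_ifs <;> simp_all <;> omega
  refine ⟨htop, fun k _ => rfl, ?_, ?_, ?_, ?_⟩
  · intro k
    induction k with
    | zero => intro _; simp [gOf]
    | succ k ih =>
      intro hk
      have hV : V n (k+1) = false := by
        by_contra hc
        have := hF.2.1 n (k+1) (by simpa using hc)
        omega
      rw [gOf, ih (by omega)]
      simp only [vx, sgn, hV]
      push_cast
      split_ifs <;> simp_all <;> omega
  · intro k
    induction k with
    | zero => intro _; rw [htop n le_rfl]; simp
    | succ k ih =>
      intro hk
      have hH : H (k+1) n = false := by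
        by_contra hc
        have := hF.1 (k+1) n (by simpa using hc)
        omega
      have h1 := gOf_col hn hF k hk n le_rfl
      rw [ih (by omega)] at h1
      simp only [hx, sgn, hH] at h1
      push_cast
      split_ifs at h1 <;> simp_all <;> omega
  · intro i hi j hj
    simp only [gOf]
    rcases sgn_cases (i + j + 1) with hs | hs <;>
      rcases vx_cases hn hF i (j+1) with hv | hv <;> rw [hs, hv] <;> simp
  · intro i hi j hj
    have h1 := gOf_col hn hF i hi j hj
    rcases sgn_cases (i + 1 + j) with hs | hs <;>
      rcases hx_cases hn hF (i+1) j with hv | hv <;> rw [hs, hv] at h1 <;> omega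

lemma fpl_surj {n : ℕ} (hn : 1 ≤ n) {H V : ℕ → ℕ → Bool} (hF : IsFPL n H V) :
    ∃ h, IsHeightFn n h ∧ heightToFPL n h = (H, V) := by
  have hht := isHeightFn_of (natHt_gOf hn hF)
  refine ⟨_, hht, ?_⟩
  set h : Fin (n+1) → Fin (n+1) → ℤ := fun i j => gOf n V i j with hdef
  have hF2 := fpl_mapsTo hn hht
  have hE : ∀ i ≤ n, ∀ j ≤ n, extH n h i j = gOf n V i j := by
    intro i hi j hj
    simp [extH, hdef, Nat.lt_succ_of_le hi, Nat.lt_succ_of_le hj]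
  have hHeq : ∀ i j, (heightToFPL n h).1 i j = H i j := by
    intro i j
    by_cases hb : 1 ≤ i ∧ i ≤ n ∧ 1 ≤ j ∧ j + 1 ≤ n
    · obtain ⟨i, rfl⟩ := Nat.exists_eq_add_of_le' hb.1
      have k1 := keyH hn hht i j (by omega) (by omega)
      rw [hE _ (by omega) _ (by omega), hE _ (by omega) _ (by omega),
        gOf_col hn hF i (by omega) j (by omega)] at k1
      have k2 : hx n H (i+1) j = hx n (heightToFPL n h).1 (i+1) j := by
        rcases sgn_cases (i + 1 + j) with hs | hs <;> rw [hs] at k1 <;> linarith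
      unfold hx at k2
      cases hA : (heightToFPL n h).1 (i+1) j <;> cases hB : H (i+1) j <;> simp_all
    · have h1 := hF.1 i j
      have h2 := hF2.1 i j
      rw [Bool.eq_iff_iff]
      exact ⟨fun hc => absurd (h2 hc) hb, fun hc => absurd (h1 hc) hb⟩
  have hVeq : ∀ i j, (heightToFPL n h).2 i j = V i j := by
    intro i j
    by_cases hb : 1 ≤ i ∧ i + 1 ≤ n ∧ 1 ≤ j ∧ j ≤ n
    · obtain ⟨j, rfl⟩ := Nat.exists_eq_add_of_le' hb.2.2.1
      have k1 := keyV hn hht i j (by omega) (by omega)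
      rw [hE _ (by omega) _ (by omega), hE _ (by omega) _ (by omega), gOf] at k1
      have k2 : vx n V i (j+1) = vx n (heightToFPL n h).2 i (j+1) := by
        rcases sgn_cases (i + j + 1) with hs | hs <;> rw [hs] at k1 <;> linarith
      unfold vx at k2
      cases hA : (heightToFPL n h).2 i (j+1) <;> cases hB : V i (j+1) <;> simp_all
    · have h1 := hF.2.1 i j
      have h2 := hF2.2.1 i j
      rw [Bool.eq_iff_iff]
      exact ⟨fun hc => absurd (h2 hc) hb, fun hc => absurd (h1 hc) hb⟩
  ext i j
  · rw [hHeq]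
  · rw [hVeq]

/-- For every `n ≥ 1`, the above map is a bijection from the set of height function
matrices of order `n` onto the set of fully-packed loop configurations of order `n`. -/
theorem stmt_19 (n : ℕ) (hn : 1 ≤ n) :
    Set.BijOn (heightToFPL n) {h | IsHeightFn n h}
      {F : (ℕ → ℕ → Bool) × (ℕ → ℕ → Bool) | IsFPL n F.1 F.2} := by
  refine ⟨fun h hh => fpl_mapsTo hn hh, fun h hh hB2 hh2 he => fpl_inj hn hh hh2 he, ?_⟩
  rintro ⟨H, V⟩ hF
  obtain ⟨h, h1, h2⟩ := fpl_surj hn hF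
  exact ⟨h, h1, h2⟩
end
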